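/- arXiv:1612.08085 — 2 statements merged into one kernel-verified Lean document; each statement's English description precedes it below -/
import Mathlib

section
/- Let R be a finite nontrivial ring with identity and let p and q be two mutually distant points of P(R). Then the number of points of P(R) that are distant to both p and q equals the number of units of R. -/
/-- A pair is admissible if it is the first row of some invertible 2×2 matrix. -/
def Admissible (R : Type*) [Ring R] (v : R × R) : Prop :=
  ∃ M : Matrix (Fin 2) (Fin 2) R, IsUnit M ∧ M 0 0 = v.1 ∧ M 0 1 = v.2

/-- The type of admissible pairs. -/
def AdmissiblePair (R : Type*) [Ring R] := {v : R × R // Admissible R v}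

/-- Two admissible pairs are associated if one is obtained from the other by left
multiplication by a unit. -/
def ProjAssoc (R : Type*) [Ring R] (v w : AdmissiblePair R) : Prop :=
  ∃ u : Rˣ, v.1.1 = (u : R) * w.1.1 ∧ v.1.2 = (u : R) * w.1.2

/-- The projective line over a ring: admissible pairs modulo unit multiples. -/
def ProjLine (R : Type*) [Ring R] := Quot (ProjAssoc R)

/-- The point of the projective line determined by an admissible pair. -/
def ProjLine.mk (R : Type*) [Ring R] (v : AdmissiblePair R) : ProjLine R :=
  Quot.mk (ProjAssoc R) v

/-- Two points are distant if (for some, equivalently any, representatives) the 2×2 matrix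
formed from the representatives is invertible. -/
def Distant (R : Type*) [Ring R] (x y : ProjLine R) : Prop :=
  ∃ (a b c d : R) (h₁ : Admissible R (a, b)) (h₂ : Admissible R (c, d)),
    x = ProjLine.mk R ⟨(a, b), h₁⟩ ∧ y = ProjLine.mk R ⟨(c, d), h₂⟩ ∧
    IsUnit !![a, b; c, d]


theorem mk_eq_mk_iff {R : Type*} [Ring R] {v w : AdmissiblePair R} :
    ProjLine.mk R v = ProjLine.mk R w ↔ ProjAssoc R v w := by
  have equiv : Equivalence (ProjAssoc R) := by
    refine ⟨fun v => ⟨1, by simp, by simp⟩, ?_, ?_⟩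
    · rintro v w ⟨u, h₁, h₂⟩
      exact ⟨u⁻¹, by simp [h₁], by simp [h₂]⟩
    · rintro v w x ⟨u, h₁, h₂⟩ ⟨u', h₃, h₄⟩
      exact ⟨u * u', by simp [h₁, h₃, mul_assoc], by simp [h₂, h₄, mul_assoc]⟩
  exact equiv.quot_mk_eq_iff v w

theorem isUnit_of_units_mul_rows {R : Type*} [Ring R] (u w : Rˣ) {a b c d : R}
    (h : IsUnit !![a, b; c, d]) : IsUnit !![u * a, u * b; w * c, w * d] := by
  have hdiag : IsUnit !![(u : R), 0; 0, (w : R)] :=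
    isUnit_iff_exists.2 ⟨!![((u⁻¹ : Rˣ) : R), 0; 0, ((w⁻¹ : Rˣ) : R)],
      by simp [Matrix.one_fin_two], by simp [Matrix.one_fin_two]⟩
  simpa using hdiag.mul h

theorem distant_mk_iff {R : Type*} [Ring R] {a b c d : R}
    (h₁ : Admissible R (a, b)) (h₂ : Admissible R (c, d)) :
    Distant R (ProjLine.mk R ⟨(a, b), h₁⟩) (ProjLine.mk R ⟨(c, d), h₂⟩) ↔
      IsUnit !![a, b; c, d] := by
  refine ⟨?_, fun h => ⟨a, b, c, d, h₁, h₂, rfl, rfl, h⟩⟩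
  rintro ⟨a', b', c', d', h₁', h₂', hx, hy, h⟩
  obtain ⟨u, hu₁, hu₂⟩ := mk_eq_mk_iff.1 hx
  obtain ⟨w, hw₁, hw₂⟩ := mk_eq_mk_iff.1 hy
  dsimp only at hu₁ hu₂ hw₁ hw₂
  rw [hu₁, hu₂, hw₁, hw₂]
  exact isUnit_of_units_mul_rows u w h

theorem isUnit_matrix_zero_one_iff {R : Type*} [Ring R] {s t : R} :
    IsUnit !![s, t; 0, 1] ↔ IsUnit s := by
  constructor
  · intro h
    obtain ⟨N, h₁, h₂⟩ := isUnit_iff_exists.1 h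
    rw [Matrix.eta_fin_two N, Matrix.one_fin_two] at h₁ h₂
    simp at h₁ h₂
    obtain ⟨⟨h₃, -⟩, h₄, -⟩ := h₁
    exact isUnit_iff_exists.2 ⟨N 0 0, by simpa [h₄] using h₃, h₂.1.1⟩
  · rintro ⟨u, rfl⟩
    exact isUnit_iff_exists.2 ⟨!![((u⁻¹ : Rˣ) : R), -(((u⁻¹ : Rˣ) : R) * t); 0, 1],
      by simp [Matrix.one_fin_two], by simp [Matrix.one_fin_two]⟩

theorem isUnit_matrix_one_zero_iff {R : Type*} [Ring R] {s t : R} :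
    IsUnit !![s, t; 1, 0] ↔ IsUnit t := by
  have hswap : IsUnit (!![0, 1; 1, 0] : Matrix (Fin 2) (Fin 2) R) :=
    isUnit_iff_exists.2 ⟨!![0, 1; 1, 0], by simp [Matrix.one_fin_two],
      by simp [Matrix.one_fin_two]⟩
  have hmul : !![s, t; 1, 0] = !![t, s; 0, 1] * !![0, 1; 1, 0] := by simp
  rw [hmul, hswap.mul_right_iff, isUnit_matrix_zero_one_iff]

theorem isUnit_combination_first_row_iff {R : Type*} [Ring R] {a b c d : R}
    (h : IsUnit !![a, b; c, d]) (s t : R) :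
    IsUnit !![s * a + t * c, s * b + t * d; a, b] ↔ IsUnit t := by
  have hmul : !![s * a + t * c, s * b + t * d; a, b] =
      !![s, t; 1, 0] * !![a, b; c, d] := by simp
  rw [hmul, h.mul_right_iff, isUnit_matrix_one_zero_iff]

theorem isUnit_combination_second_row_iff {R : Type*} [Ring R] {a b c d : R}
    (h : IsUnit !![a, b; c, d]) (s t : R) :
    IsUnit !![s * a + t * c, s * b + t * d; c, d] ↔ IsUnit s := by
  have hmul : !![s * a + t * c, s * b + t * d; c, d] =
      !![s, t; 0, 1] * !![a, b; c, d] := by simp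
  rw [hmul, h.mul_right_iff, isUnit_matrix_zero_one_iff]

theorem exists_row_combination {R : Type*} [Ring R] {a b c d : R}
    (h : IsUnit !![a, b; c, d]) (e f : R) :
    ∃ s t : R, e = s * a + t * c ∧ f = s * b + t * d := by
  obtain ⟨N, -, hN⟩ := isUnit_iff_exists.1 h
  have hmul : !![e, f; 0, 0] * N * !![a, b; c, d] = !![e, f; 0, 0] := by
    rw [mul_assoc, hN, mul_one]
  rw [Matrix.eta_fin_two (!![e, f; 0, 0] * N)] at hmul
  refine ⟨(!![e, f; 0, 0] * N) 0 0, (!![e, f; 0, 0] * N) 0 1, ?_, ?_⟩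
  · simpa using (congrFun (congrFun hmul 0) 0).symm
  · simpa using (congrFun (congrFun hmul 0) 1).symm

theorem row_combination_injective {R : Type*} [Ring R] {a b c d : R}
    (h : IsUnit !![a, b; c, d]) {s t s' t' : R}
    (h₁ : s * a + t * c = s' * a + t' * c) (h₂ : s * b + t * d = s' * b + t' * d) :
    s = s' ∧ t = t' := by
  have hmul : !![s, t; 0, 0] * !![a, b; c, d] = !![s', t'; 0, 0] * !![a, b; c, d] := by
    simp [h₁, h₂]
  have heq := h.mul_right_cancel hmul
  exact ⟨by simpa using congrFun (congrFun heq 0) 0, by simpa using congrFun (congrFun heq 0) 1⟩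

/-- The number of points distant to both of two mutually distant points of the projective
line over a finite nontrivial ring `R` equals the number of units of `R`. -/
theorem card_common_distant_set (R : Type*) [Ring R] [Fintype R] [Nontrivial R]
    (p q : ProjLine R) (hpq : Distant R p q) :
    Nat.card {x : ProjLine R | Distant R x p ∧ Distant R x q} = Nat.card Rˣ := by
  obtain ⟨a, b, c, d, hp, hq, rfl, rfl, h⟩ := hpq
  have hadm (u : Rˣ) : Admissible R (1 * a + u * c, 1 * b + u * d) :=
    ⟨_, (isUnit_combination_first_row_iff h 1 u).2 u.isUnit, rfl, rfl⟩
  symm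
  refine Nat.card_eq_of_bijective (fun u : Rˣ => ⟨ProjLine.mk R ⟨_, hadm u⟩,
    (distant_mk_iff _ _).2 ((isUnit_combination_first_row_iff h 1 u).2 u.isUnit),
    (distant_mk_iff _ _).2 ((isUnit_combination_second_row_iff h 1 u).2 isUnit_one)⟩) ⟨?_, ?_⟩
  · intro u u' huu'
    obtain ⟨w, hw₁, hw₂⟩ := mk_eq_mk_iff.1 (congrArg Subtype.val huu')
    simp only [mul_add, ← mul_assoc] at hw₁ hw₂
    obtain ⟨h₁, h₂⟩ := row_combination_injective h hw₁ hw₂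
    rw [mul_one] at h₁
    exact Units.ext (by rw [h₂, ← h₁, one_mul])
  · rintro ⟨⟨⟨⟨e, f⟩, hef⟩⟩, hxp, hxq⟩
    obtain ⟨s, t, rfl, rfl⟩ := exists_row_combination h e f
    obtain ⟨v, rfl⟩ := (isUnit_combination_first_row_iff h s t).1 ((distant_mk_iff hef hp).1 hxp)
    obtain ⟨w, rfl⟩ := (isUnit_combination_second_row_iff h s v).1 ((distant_mk_iff hef hq).1 hxq)
    refine ⟨w⁻¹ * v, Subtype.ext (mk_eq_mk_iff.2 ⟨w⁻¹, ?_, ?_⟩)⟩ <;>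
      simp [mul_add, mul_assoc]
end

section
/- Let F be a finite field with q elements and let m ≥ 1. Then the clique number of the distant graph of the matrix ring M_m(F) — the maximal cardinality of a set of pairwise distant points of P(M_m(F)) — equals q^m + 1. -/
section DistantGraph

variable {R : Type*} [Ring R]

theorem projAssoc_equivalence : Equivalence (ProjAssoc R) where
  refl v := ⟨1, by simp, by simp⟩
  symm := by
    rintro v w ⟨u, h₁, h₂⟩
    exact ⟨u⁻¹, by simp [h₁], by simp [h₂]⟩
  trans := by
    rintro v w z ⟨u, h₁, h₂⟩ ⟨u', h₁', h₂'⟩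
    exact ⟨u * u', by simp [h₁, h₁', mul_assoc], by simp [h₂, h₂', mul_assoc]⟩

theorem Admissible.exists_mul_add_mul_eq_one {v : R × R} (h : Admissible R v) :
    ∃ p r : R, v.1 * p + v.2 * r = 1 := by
  obtain ⟨M, hM, h₁, h₂⟩ := h
  obtain ⟨N, hN⟩ := hM.exists_right_inv
  refine ⟨N 0 0, N 1 0, ?_⟩
  rw [← h₁, ← h₂, ← Fin.sum_univ_two (fun i => M 0 i * N i 0), ← Matrix.mul_apply, hN,
    Matrix.one_apply_eq]

/-- If two points are distant then, for all representatives, some column vector is sent to `1` by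
the first and to `0` by the second. -/
theorem Distant.exists_mul_add_mul_eq {v w : AdmissiblePair R}
    (h : Distant R (ProjLine.mk R v) (ProjLine.mk R w)) :
    ∃ p r : R, v.1.1 * p + v.1.2 * r = 1 ∧ w.1.1 * p + w.1.2 * r = 0 := by
  obtain ⟨a, b, c, d, h₁, h₂, hx, hy, hM⟩ := h
  obtain ⟨u, hu₁, hu₂⟩ := projAssoc_equivalence.quot_mk_eq_iff _ _ |>.1 hx
  obtain ⟨t, ht₁, ht₂⟩ := projAssoc_equivalence.quot_mk_eq_iff _ _ |>.1 hy
  obtain ⟨N, hN⟩ := hM.exists_right_inv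
  have e₀ : a * N 0 0 + b * N 1 0 = 1 := by
    simpa [Matrix.mul_apply, Fin.sum_univ_two] using congrFun (congrFun hN 0) 0
  have e₁ : c * N 0 0 + d * N 1 0 = 0 := by
    simpa [Matrix.mul_apply, Fin.sum_univ_two] using congrFun (congrFun hN 1) 0
  refine ⟨N 0 0 * ↑u⁻¹, N 1 0 * ↑u⁻¹, ?_, ?_⟩
  · calc v.1.1 * (N 0 0 * ↑u⁻¹) + v.1.2 * (N 1 0 * ↑u⁻¹)
        = u * (a * N 0 0 + b * N 1 0) * ↑u⁻¹ := by
          rw [hu₁, hu₂]; simp only [mul_add, add_mul, mul_assoc]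
      _ = 1 := by rw [e₀]; simp
  · calc w.1.1 * (N 0 0 * ↑u⁻¹) + w.1.2 * (N 1 0 * ↑u⁻¹)
        = t * (c * N 0 0 + d * N 1 0) * ↑u⁻¹ := by
          rw [ht₁, ht₂]; simp only [mul_add, add_mul, mul_assoc]
      _ = 0 := by rw [e₁]; simp

theorem Distant.ne [Nontrivial R] {x y : ProjLine R} (h : Distant R x y) : x ≠ y := by
  rintro rfl
  induction x using Quot.ind with
  | mk v =>
    obtain ⟨p, r, h₁, h₀⟩ := Distant.exists_mul_add_mul_eq h
    exact one_ne_zero (h₁.symm.trans h₀)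

theorem isUnit_of_mul_eq_one_of_mul_eq_one {M N : Matrix (Fin 2) (Fin 2) R}
    (h₁ : M * N = 1) (h₂ : N * M = 1) : IsUnit M :=
  ⟨⟨M, N, h₁, h₂⟩, rfl⟩

theorem isUnit_one_zero_one (a : R) : IsUnit !![1, a; 0, 1] :=
  isUnit_of_mul_eq_one_of_mul_eq_one (N := !![1, -a; 0, 1])
    (by simp [Matrix.one_fin_two]) (by simp [Matrix.one_fin_two])

theorem isUnit_zero_one_one (a : R) : IsUnit !![0, 1; 1, a] :=
  isUnit_of_mul_eq_one_of_mul_eq_one (N := !![-a, 1; 1, 0])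
    (by simp [Matrix.one_fin_two]) (by simp [Matrix.one_fin_two])

theorem isUnit_one_one {a b : R} (h : IsUnit (b - a)) : IsUnit !![1, a; 1, b] := by
  have : !![1, a; 1, b] = !![1, 0; 1, 1] * !![1, a; 0, b - a] := by simp
  obtain ⟨u, hu⟩ := h
  rw [this, ← hu]
  refine IsUnit.mul ?_ ?_
  · exact isUnit_of_mul_eq_one_of_mul_eq_one (N := !![1, 0; -1, 1])
      (by simp [Matrix.one_fin_two]) (by simp [Matrix.one_fin_two])
  · exact isUnit_of_mul_eq_one_of_mul_eq_one (N := !![1, -a * ↑u⁻¹; 0, ↑u⁻¹])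
      (by simp [Matrix.one_fin_two]) (by simp [Matrix.one_fin_two])

theorem admissible_one_left (a : R) : Admissible R (1, a) :=
  ⟨!![1, a; 0, 1], isUnit_one_zero_one a, rfl, rfl⟩

theorem admissible_zero_one : Admissible R (0, 1) :=
  ⟨!![0, 1; 1, 0], isUnit_zero_one_one 0, rfl, rfl⟩

/-- The points of the projective line over `R` coming from the projective line over a field `K`
mapping to `R`, with `none` the point at infinity. -/
def projLineOfOption {K : Type*} [Field K] (f : K →+* R) : Option K → ProjLine R
  | none => ProjLine.mk R ⟨(0, 1), admissible_zero_one⟩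
  | some k => ProjLine.mk R ⟨(1, f k), admissible_one_left (f k)⟩

theorem distant_projLineOfOption {K : Type*} [Field K] (f : K →+* R) {x y : Option K}
    (h : x ≠ y) : Distant R (projLineOfOption f x) (projLineOfOption f y) := by
  match x, y with
  | none, none => exact absurd rfl h
  | none, some k =>
    exact ⟨0, 1, 1, f k, _, _, rfl, rfl, isUnit_zero_one_one _⟩
  | some k, none =>
    exact ⟨1, f k, 0, 1, _, _, rfl, rfl, isUnit_one_zero_one _⟩
  | some k, some l =>
    refine ⟨1, f k, 1, f l, _, _, rfl, rfl, isUnit_one_one ?_⟩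
    rw [← map_sub]
    exact (IsUnit.mk0 _ (sub_ne_zero.2 fun e => h (congrArg some e.symm))).map f

/-- A field mapping to `R` gives a clique in the distant graph, its projective line. -/
theorem exists_clique_of_ringHom [Nontrivial R] {K : Type*} [Field K] [Fintype K] (f : K →+* R) :
    ∃ S : Finset (ProjLine R), S.card = Fintype.card K + 1 ∧
      ∀ x ∈ S, ∀ y ∈ S, x ≠ y → Distant R x y := by
  have hinj : Function.Injective (projLineOfOption f) := fun x y hxy => by
    by_contra h
    exact (distant_projLineOfOption f h).ne hxy
  refine ⟨Finset.univ.map ⟨_, hinj⟩, by simp, ?_⟩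
  simp only [Finset.mem_map, Finset.mem_univ, true_and, Function.Embedding.coeFn_mk]
  rintro _ ⟨x, rfl⟩ _ ⟨y, rfl⟩ hxy
  exact distant_projLineOfOption f fun e => hxy (congrArg _ e)

end DistantGraph

/-- Pairwise distant points correspond to subspaces of `F ^ (2 * m)` of dimension `m` with pairwise
trivial intersection, so counting nonzero vectors bounds their number. -/
theorem card_le_of_pairwise_distant {F : Type*} [Field F] [Fintype F] {m : ℕ} (hm : m ≠ 0)
    (S : Finset (ProjLine (Matrix (Fin m) (Fin m) F)))
    (hS : ∀ x ∈ S, ∀ y ∈ S, x ≠ y → Distant (Matrix (Fin m) (Fin m) F) x y) :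
    S.card ≤ Fintype.card F ^ m + 1 := by
  classical
  choose rep hrep using fun x : ProjLine (Matrix (Fin m) (Fin m) F) => Quot.exists_rep x
  have hcancel : ∀ x ∈ S, ∀ y ∈ S, ∀ v w : Fin m → F, v ≠ 0 →
      Matrix.vecMul v (rep x).1.1 = Matrix.vecMul w (rep y).1.1 →
      Matrix.vecMul v (rep x).1.2 = Matrix.vecMul w (rep y).1.2 → x = y := by
    intro x hx y hy v w hv h₁ h₂
    by_contra hxy
    have hd := hS x hx y hy hxy
    rw [← hrep x, ← hrep y] at hd
    obtain ⟨p, r, e₁, e₀⟩ := Distant.exists_mul_add_mul_eq hd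
    apply hv
    rw [← Matrix.vecMul_one v, ← e₁, Matrix.vecMul_add, ← Matrix.vecMul_vecMul,
      ← Matrix.vecMul_vecMul, h₁, h₂, Matrix.vecMul_vecMul, Matrix.vecMul_vecMul,
      ← Matrix.vecMul_add, e₀, Matrix.vecMul_zero]
  have hinj : ∀ x, ∀ v w : Fin m → F,
      Matrix.vecMul v (rep x).1.1 = Matrix.vecMul w (rep x).1.1 →
      Matrix.vecMul v (rep x).1.2 = Matrix.vecMul w (rep x).1.2 → v = w := by
    intro x v w h₁ h₂
    obtain ⟨p, r, e⟩ := (rep x).2.exists_mul_add_mul_eq_one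
    rw [← Matrix.vecMul_one v, ← Matrix.vecMul_one w, ← e]
    simp only [Matrix.vecMul_add, ← Matrix.vecMul_vecMul, h₁, h₂]
  have hcard := Finset.card_le_card_of_injOn
    (s := S ×ˢ ({0}ᶜ : Finset (Fin m → F))) (t := ({0}ᶜ : Finset ((Fin m → F) × (Fin m → F))))
    (fun z => (Matrix.vecMul z.2 (rep z.1).1.1, Matrix.vecMul z.2 (rep z.1).1.2))
    (by
      rintro ⟨x, v⟩ hz
      simp only [Finset.coe_product, Set.mem_prod, Finset.mem_coe, Finset.mem_compl,
        Finset.mem_singleton] at hz ⊢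
      intro h
      rw [Prod.mk_eq_zero] at h
      exact hz.2 (hinj x v 0 (by simp [h.1]) (by simp [h.2])))
    (by
      rintro ⟨x, v⟩ hz ⟨y, w⟩ hz' h
      simp only [Finset.coe_product, Set.mem_prod, Finset.mem_coe, Finset.mem_compl,
        Finset.mem_singleton] at hz hz'
      simp only [Prod.mk.injEq] at h
      obtain rfl := hcancel x hz.1 y hz'.1 v w hz.2 h.1 h.2
      rw [hinj x v w h.1 h.2])
  simp only [Finset.card_product, Finset.card_compl, Finset.card_singleton, Fintype.card_prod,
    Fintype.card_fun, Fintype.card_fin] at hcard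
  have hlt : 1 < Fintype.card F ^ m := Nat.one_lt_pow hm Fintype.one_lt_card
  generalize Fintype.card F ^ m = Q at hcard hlt ⊢
  obtain ⟨k, rfl⟩ : ∃ k, Q = k + 1 := ⟨Q - 1, by omega⟩
  have hsq : (k + 1) * (k + 1) - 1 = (k + 1 + 1) * k := by
    rw [Nat.sub_eq_iff_eq_add (by nlinarith)]; ring
  rw [hsq, Nat.add_sub_cancel] at hcard
  exact Nat.le_of_mul_le_mul_right hcard (by omega)

/-- The clique number of the distant graph of `P(M_m(F))`, `|F| = q`, `m ≥ 1`, is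
`q^m + 1`. -/
theorem clique_number_matrix_ring (F : Type*) [Field F] [Fintype F] (q m : ℕ)
    (hq : Fintype.card F = q) (hm : 1 ≤ m) :
    IsGreatest {n : ℕ | ∃ S : Finset (ProjLine (Matrix (Fin m) (Fin m) F)),
        S.card = n ∧ ∀ x ∈ S, ∀ y ∈ S, x ≠ y → Distant (Matrix (Fin m) (Fin m) F) x y}
      (q ^ m + 1) := by
  subst hq
  have : NeZero m := ⟨by omega⟩
  constructor
  · obtain ⟨p, _⟩ := CharP.exists F
    have : Fact p.Prime := ⟨CharP.char_is_prime F p⟩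
    let K := FiniteField.Extension F p m
    let b : Module.Basis (Fin m) F K :=
      Module.finBasisOfFinrankEq F K (FiniteField.finrank_extension F p m)
    have : Fintype K := Fintype.ofFinite K
    have hK : Fintype.card K = Fintype.card F ^ m := by
      simpa using Module.card_fintype b
    rw [← hK]
    exact exists_clique_of_ringHom (Algebra.leftMulMatrix b).toRingHom
  · rintro n ⟨S, rfl, hS⟩
    exact card_le_of_pairwise_distant (by omega) S hS
end
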